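/- Let n_1, n_2, n_3 be positive integers with n = n_1 + n_2 + n_3, let ω = e^{2πi/3}, and let Λ = (λ_1,…,λ_n) assign λ_i = ω^{j−1} ∈ ℂ to every index i in the j-th block (the first n_1 indices form block 1, the next n_2 block 2, the last n_3 block 3). Then the moment-angle manifold Z^ℂ(Λ) = {z ∈ ℂ^n : ∑_{i=1}^n λ_i |z_i|² = 0 and ∑_{i=1}^n |z_i|² = 1} is homeomorphic to the product of spheres S^{2n_1 − 1} × S^{2n_2 − 1} × S^{2n_3 − 1}. -/

import Mathlib

open scoped BigOperators

/-- The moment-angle manifold `Z^ℂ(Λ)` of a configuration of complex numbers. -/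
def ZC {n : ℕ} (Λ : Fin n → ℂ) : Set (Fin n → ℂ) :=
  {z | (∑ i, Λ i * (Complex.normSq (z i) : ℂ)) = 0 ∧ (∑ i, Complex.normSq (z i)) = 1}
/-- The configuration associated to the cyclic partition `n = n₁ + n₂ + n₃`: with
`ω = e^{2πi/3}`, each index in the `j`-th block is assigned `ω^{j-1}`. -/
noncomputable def triConfig (n₁ n₂ n₃ : ℕ) : Fin (n₁ + n₂ + n₃) → ℂ :=
  fun i =>
    if (i : ℕ) < n₁ then 1
    else if (i : ℕ) < n₁ + n₂ then Complex.exp (2 * Real.pi * Complex.I / 3)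
    else Complex.exp (2 * Real.pi * Complex.I / 3) ^ 2

/-- `ℂⁿ` is homeomorphic to `ℝ²ⁿ` by a map multiplying the squared Euclidean norm by a given
`c > 0`. -/
theorem exists_homeomorph_norm_sq_eq (n : ℕ) {c : ℝ} (hc : 0 < c) :
    ∃ e : (Fin n → ℂ) ≃ₜ EuclideanSpace ℝ (Fin (2 * n)),
      ∀ z, ‖e z‖ ^ 2 = c * ∑ i, Complex.normSq (z i) := by
  have hrank : Module.finrank ℝ (EuclideanSpace ℂ (Fin n)) = 2 * n := by
    rw [finrank_real_of_complex, finrank_euclideanSpace_fin]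
  let L : EuclideanSpace ℂ (Fin n) ≃ₗᵢ[ℝ] EuclideanSpace ℝ (Fin (2 * n)) :=
    ((stdOrthonormalBasis ℝ (EuclideanSpace ℂ (Fin n))).reindex (finCongr hrank)).repr
  refine ⟨((PiLp.homeomorph 2 fun _ : Fin n => ℂ).symm.trans L.toHomeomorph).trans
    (Homeomorph.smulOfNeZero √c (Real.sqrt_pos.2 hc).ne'), fun z => ?_⟩
  have hL : ‖L (WithLp.toLp 2 z)‖ ^ 2 = ∑ i, Complex.normSq (z i) := by
    simp [L.norm_map, EuclideanSpace.norm_sq_eq, Complex.normSq_eq_norm_sq]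
  change ‖√c • L (WithLp.toLp 2 z)‖ ^ 2 = _
  rw [norm_smul, mul_pow, hL, Real.norm_eq_abs, sq_abs, Real.sq_sqrt hc.le]

theorem exp_two_pi_mul_I_div_three :
    Complex.exp (2 * Real.pi * Complex.I / 3) = ⟨-(1 / 2), √3 / 2⟩ := by
  have h : (2 * Real.pi * Complex.I / 3 : ℂ) = ((Real.pi - Real.pi / 3 : ℝ) : ℂ) * Complex.I := by
    push_cast
    ring
  rw [h]
  apply Complex.ext
  · rw [Complex.exp_ofReal_mul_I_re, Real.cos_pi_sub, Real.cos_pi_div_three]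
  · rw [Complex.exp_ofReal_mul_I_im, Real.sin_pi_sub, Real.sin_pi_div_three]

/-- A real linear combination of the cube roots of unity vanishes exactly when its coefficients
agree. -/
theorem sum_cube_roots_eq_zero_iff (a b c : ℝ) :
    (a + Complex.exp (2 * Real.pi * Complex.I / 3) * b +
      Complex.exp (2 * Real.pi * Complex.I / 3) ^ 2 * c : ℂ) = 0 ↔ a = b ∧ b = c := by
  have h3 : (0 : ℝ) < √3 := by positivity
  have hs : √3 * √3 = 3 := Real.mul_self_sqrt (by norm_num)
  rw [exp_two_pi_mul_I_div_three, Complex.ext_iff]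
  simp only [pow_two, Complex.add_re, Complex.add_im, Complex.mul_re, Complex.mul_im,
    Complex.ofReal_re, Complex.ofReal_im, Complex.zero_re, Complex.zero_im]
  constructor
  · rintro ⟨hre, him⟩
    have hbc : b = c := by
      have : √3 * (b - c) = 0 := by linear_combination 2 * him
      rcases mul_eq_zero.1 this with h | h
      · exact absurd h h3.ne'
      · exact sub_eq_zero.1 h
    subst hbc
    exact ⟨by linear_combination hre + b / 4 * hs, rfl⟩
  · rintro ⟨rfl, rfl⟩
    exact ⟨by linear_combination -a / 4 * hs, by ring⟩

/-- Membership in `Z^ℂ(Λ)` for the cyclic partition, in terms of the three blocks. -/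
theorem append_mem_ZC_triConfig_iff {n₁ n₂ n₃ : ℕ}
    (x : Fin n₁ → ℂ) (y : Fin n₂ → ℂ) (w : Fin n₃ → ℂ) :
    Fin.append (Fin.append x y) w ∈ ZC (triConfig n₁ n₂ n₃) ↔
      3 * ∑ i, Complex.normSq (x i) = 1 ∧ 3 * ∑ i, Complex.normSq (y i) = 1 ∧
        3 * ∑ i, Complex.normSq (w i) = 1 := by
  have hΛ₁ (i : Fin n₁) : triConfig n₁ n₂ n₃ (Fin.castAdd n₃ (Fin.castAdd n₂ i)) = 1 := by
    simp [triConfig]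
  have hΛ₂ (i : Fin n₂) : triConfig n₁ n₂ n₃ (Fin.castAdd n₃ (Fin.natAdd n₁ i)) =
      Complex.exp (2 * Real.pi * Complex.I / 3) := by
    simp [triConfig]
  have hΛ₃ (i : Fin n₃) : triConfig n₁ n₂ n₃ (Fin.natAdd (n₁ + n₂) i) =
      Complex.exp (2 * Real.pi * Complex.I / 3) ^ 2 := by
    have h : ¬ n₁ + n₂ + (i : ℕ) < n₁ := by omega
    simp [triConfig, h]
  simp only [ZC, Set.mem_ofPred_eq, Fin.sum_univ_add, Fin.append_left, Fin.append_right,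
    hΛ₁, hΛ₂, hΛ₃, one_mul, ← Finset.mul_sum, ← Complex.ofReal_sum, sum_cube_roots_eq_zero_iff]
  constructor
  · rintro ⟨⟨hxy, hyw⟩, hsum⟩
    refine ⟨?_, ?_, ?_⟩ <;> linarith
  · rintro ⟨hx, hy, hw⟩
    refine ⟨⟨?_, ?_⟩, ?_⟩ <;> linarith

/-- Case `ℓ = 1` of the classification of moment-angle manifolds: for the cyclic partition
`n = n₁ + n₂ + n₃`, the moment-angle manifold `Z^ℂ(Λ)` is homeomorphic to the triple
product of spheres `S^{2n₁−1} × S^{2n₂−1} × S^{2n₃−1}`. -/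
theorem ZC_triple_product_of_spheres {n₁ n₂ n₃ : ℕ}
    (h₁ : 0 < n₁) (h₂ : 0 < n₂) (h₃ : 0 < n₃) :
    Nonempty (↥(ZC (triConfig n₁ n₂ n₃)) ≃ₜ
      (Metric.sphere (0 : EuclideanSpace ℝ (Fin (2 * n₁))) 1 ×
        Metric.sphere (0 : EuclideanSpace ℝ (Fin (2 * n₂))) 1 ×
        Metric.sphere (0 : EuclideanSpace ℝ (Fin (2 * n₃))) 1)) := by
  obtain ⟨e₁, he₁⟩ := exists_homeomorph_norm_sq_eq n₁ three_pos
  obtain ⟨e₂, he₂⟩ := exists_homeomorph_norm_sq_eq n₂ three_pos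
  obtain ⟨e₃, he₃⟩ := exists_homeomorph_norm_sq_eq n₃ three_pos
  have hsphere {m : ℕ} (v : EuclideanSpace ℝ (Fin m)) :
      v ∈ Metric.sphere 0 1 ↔ ‖v‖ ^ 2 = 1 := by
    rw [mem_sphere_zero_iff_norm, pow_eq_one_iff_of_nonneg (norm_nonneg v) two_ne_zero]
  let blocks : ((Fin n₁ → ℂ) × (Fin n₂ → ℂ)) × (Fin n₃ → ℂ) ≃ₜ (Fin (n₁ + n₂ + n₃) → ℂ) :=
    ((Fin.appendHomeomorph n₁ n₂).prodCongr (Homeomorph.refl _)).trans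
      (Fin.appendHomeomorph (n₁ + n₂) n₃)
  let e := blocks.symm.trans
    ((Homeomorph.prodAssoc _ _ _).trans (e₁.prodCongr (e₂.prodCongr e₃)))
  have he (z : Fin (n₁ + n₂ + n₃) → ℂ) : z ∈ ZC (triConfig n₁ n₂ n₃) ↔
      e z ∈ Metric.sphere 0 1 ×ˢ Metric.sphere 0 1 ×ˢ Metric.sphere 0 1 := by
    obtain ⟨⟨⟨x, y⟩, w⟩, rfl⟩ := blocks.surjective z
    have hz : e (blocks ((x, y), w)) = (e₁ x, e₂ y, e₃ w) := by
      simp only [e, Homeomorph.trans_apply, Homeomorph.symm_apply_apply]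
      rfl
    rw [hz, Set.mem_prod, Set.mem_prod, hsphere, hsphere, hsphere, he₁, he₂, he₃]
    exact append_mem_ZC_triConfig_iff x y w
  exact ⟨(e.subtype he).trans ((Homeomorph.Set.prod _ _).trans
    ((Homeomorph.refl _).prodCongr (Homeomorph.Set.prod _ _)))⟩
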